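/- Let T₁ and T₂ be full binary trees with the same number of leaves that share a common subtree S, occurring at the same leaf positions in both trees. Then in any minimal-length sequence of rotations transforming T₁ into T₂ (a sequence of length d_R(T₁, T₂)), no rotation alters S: every intermediate tree in the sequence contains S as a subtree at the same leaf positions. -/

import Mathlib

/-- Full binary trees: ordered rooted trees in which every internal node has
exactly two children.  A `leaf` has one leaf; `node l r` has the leaves of `l`
followed by the leaves of `r` in left-to-right order. -/
inductive BT : Type
  | leaf : BT
  | node : BT → BT → BT
deriving DecidableEq

namespace BT

/-- The number of leaves (the size) of a full binary tree. -/
def numLeaves : BT → ℕ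
  | leaf => 1
  | node l r => numLeaves l + numLeaves r

/-- A single rotation (left or right) performed at some node of the tree.
A right rotation replaces a subtree `(A ∧ B) ∧ C` by `A ∧ (B ∧ C)`; a left
rotation is the inverse.  The left-to-right order of leaves is unchanged. -/
inductive Rot : BT → BT → Prop
  | rotR (a b c : BT) : Rot (node (node a b) c) (node a (node b c))
  | rotL (a b c : BT) : Rot (node a (node b c)) (node (node a b) c)
  | congL {l l' : BT} (r : BT) : Rot l l' → Rot (node l r) (node l' r)
  | congR (l : BT) {r r' : BT} : Rot r r' → Rot (node l r) (node l r')

/-- `RotSeq n t u` : there is a sequence of exactly `n` rotations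
transforming `t` into `u`. -/
inductive RotSeq : ℕ → BT → BT → Prop
  | refl (t : BT) : RotSeq 0 t t
  | step {n : ℕ} {t u v : BT} : Rot t u → RotSeq n u v → RotSeq (n + 1) t v

/-- The rotation distance between two trees: the least number of rotations
needed to transform one into the other. -/
noncomputable def rotDist (t u : BT) : ℕ := sInf {n | RotSeq n t u}

/-- `OccursAt S T p` : the subtree of `T` at the path `p` (a list of
directions, `false` = left child, `true` = right child) is exactly `S`. -/
inductive OccursAt : BT → BT → List Bool → Prop
  | here (T : BT) : OccursAt T T []
  | left {S l : BT} {p : List Bool} (r : BT) :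
      OccursAt S l p → OccursAt S (node l r) (false :: p)
  | right (l : BT) {S r : BT} {p : List Bool} :
      OccursAt S r p → OccursAt S (node l r) (true :: p)

/-- Replace the subtree at path `p` of `T` by `R`. -/
def replaceAt : BT → List Bool → BT → BT
  | _, [], R => R
  | leaf, _ :: _, _ => leaf
  | node l r, false :: p, R => node (replaceAt l p R) r
  | node l r, true :: p, R => node l (replaceAt r p R)

/-- The number of leaves of `T` lying strictly to the left of the subtree at
path `p`; together with the size of that subtree this determines the interval
of leaf positions it spans. -/
def leavesBefore : BT → List Bool → ℕ
  | _, [] => 0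
  | leaf, _ :: _ => 0
  | node l _, false :: p => leavesBefore l p
  | node l r, true :: p => numLeaves l + leavesBefore r p

/-- Build a chain of pendant subtrees above the tree `rest`.  Each entry
`(b, t)` attaches the pendant subtree `t` as the left child of its parent when
`b = true` and as the right child when `b = false`; the parent of each pendant
subtree is the grandparent of the next one, and depths increase along the
list. -/
def buildChain : List (Bool × BT) → BT → BT
  | [], rest => rest
  | (true, t) :: L, rest => node t (buildChain L rest)
  | (false, t) :: L, rest => node (buildChain L rest) t

/-- The number of leaves lying strictly to the left of the `j`-th pendant
subtree inside the chain `buildChain L rest` (relative to the root of the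
chain). -/
def pendantOffset : List (Bool × BT) → BT → ℕ → ℕ
  | [], _, _ => 0
  | (b, _) :: L, rest, 0 => if b then 0 else numLeaves (buildChain L rest)
  | (b, t) :: L, rest, j + 1 =>
      (if b then numLeaves t else 0) + pendantOffset L rest j

/-- `IsCommonChain T₁ T₂ p₁ p₂ bs ts R₁ R₂` : the pendant subtrees `ts` form a
common chain of `T₁` and `T₂`, rooted at path `p₁` in `T₁` (with the `j`-th
pendant subtree a left child of its parent iff `bs j = true`) and at path `p₂`
in `T₂` (with all the sides reversed), with the trees `R₁`, `R₂` hanging below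
the chain, and with each pendant subtree occupying the same interval of leaf
positions in `T₁` and in `T₂`. -/
def IsCommonChain (T₁ T₂ : BT) (p₁ p₂ : List Bool) (bs : List Bool)
    (ts : List BT) (R₁ R₂ : BT) : Prop :=
  bs.length = ts.length ∧
  OccursAt (buildChain (bs.zip ts) R₁) T₁ p₁ ∧
  OccursAt (buildChain ((bs.map fun b => !b).zip ts) R₂) T₂ p₂ ∧
  ∀ j < ts.length,
    leavesBefore T₁ p₁ + pendantOffset (bs.zip ts) R₁ j =
      leavesBefore T₂ p₂ + pendantOffset ((bs.map fun b => !b).zip ts) R₂ j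

/-- One application of the subtree reduction rule to a pair of trees: a common
subtree `S` with at least two leaves, occurring at the same leaf positions in
both trees, is replaced in each tree by a single placeholder leaf. -/
def SubtreeStep (P Q : BT × BT) : Prop :=
  ∃ (S : BT) (p₁ p₂ : List Bool),
    2 ≤ numLeaves S ∧
    OccursAt S P.1 p₁ ∧ OccursAt S P.2 p₂ ∧
    leavesBefore P.1 p₁ = leavesBefore P.2 p₂ ∧
    Q.1 = replaceAt P.1 p₁ leaf ∧ Q.2 = replaceAt P.2 p₂ leaf

/-- One application of the common chain reduction rule to a pair of trees: a
common chain of more than three pendant subtrees is replaced in both trees by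
a common chain of three pendant leaves, ordered the same way in both trees. -/
def ChainStep (P Q : BT × BT) : Prop :=
  ∃ (p₁ p₂ bs cs : List Bool) (ts : List BT) (R₁ R₂ : BT),
    4 ≤ ts.length ∧ cs.length = 3 ∧
    IsCommonChain P.1 P.2 p₁ p₂ bs ts R₁ R₂ ∧
    Q.1 = replaceAt P.1 p₁ (buildChain (cs.zip [leaf, leaf, leaf]) R₁) ∧
    Q.2 = replaceAt P.2 p₂
      (buildChain ((cs.map fun b => !b).zip [leaf, leaf, leaf]) R₂) ∧
    IsCommonChain Q.1 Q.2 p₁ p₂ cs [leaf, leaf, leaf] R₁ R₂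

/-- One application of either reduction rule. -/
def RedStep (P Q : BT × BT) : Prop := SubtreeStep P Q ∨ ChainStep P Q

/-- A pair of trees is fully reduced when neither reduction rule applies. -/
def Reduced (P : BT × BT) : Prop := ∀ Q, ¬ RedStep P Q

/-- `ExhaustiveReduction P Q` : the pair `Q` is obtained from the pair `P` by
applying the subtree reduction rule and the common chain reduction rule
exhaustively, i.e. repeatedly until neither rule applies. -/
def ExhaustiveReduction (P Q : BT × BT) : Prop :=
  Relation.ReflTransGen RedStep P Q ∧ Reduced Q

end BT

namespace BT

theorem numLeaves_pos (T : BT) : 0 < T.numLeaves := by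
  induction T with
  | leaf => simp [numLeaves]
  | node l r ihl _ => simp only [numLeaves]; omega

theorem Rot.numLeaves_eq {T U : BT} (h : Rot T U) : T.numLeaves = U.numLeaves := by
  induction h <;> simp only [numLeaves] <;> omega

/-! ### Subtrees located by leaf position -/

/-- `S` is a subtree of `T` whose first leaf has position `a`, where the leaves of `T` are
numbered from `k` on. -/
def SubtreeFrom (S : BT) (a : ℕ) : ℕ → BT → Prop
  | k, leaf => S = leaf ∧ k = a
  | k, node l r => (S = node l r ∧ k = a) ∨ SubtreeFrom S a k l ∨
      SubtreeFrom S a (k + l.numLeaves) r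

/-- Some subtree of `T` has exactly the leaves `a, …, a + m - 1`, where the leaves of `T` are
numbered from `k` on. -/
def HasInterval (a m : ℕ) : ℕ → BT → Prop
  | k, leaf => m = 1 ∧ k = a
  | k, node l r => (m = (node l r).numLeaves ∧ k = a) ∨ HasInterval a m k l ∨
      HasInterval a m (k + l.numLeaves) r

theorem SubtreeFrom.self (T : BT) (k : ℕ) : SubtreeFrom T k k T := by
  cases T <;> simp [SubtreeFrom]

theorem OccursAt.subtreeFrom {S T : BT} {p : List Bool} (h : OccursAt S T p) (k : ℕ) :
    SubtreeFrom S (k + leavesBefore T p) k T := by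
  induction h generalizing k with
  | here T => simpa [leavesBefore] using SubtreeFrom.self T k
  | left r _ ih => exact Or.inr (Or.inl (ih k))
  | right l _ ih =>
    refine Or.inr (Or.inr ?_)
    simpa [leavesBefore, Nat.add_assoc] using ih (k + l.numLeaves)

theorem SubtreeFrom.exists_occursAt {S T : BT} {a k : ℕ} (h : SubtreeFrom S a k T) :
    ∃ p, OccursAt S T p ∧ k + leavesBefore T p = a := by
  induction T generalizing k with
  | leaf =>
    obtain ⟨rfl, rfl⟩ := h
    exact ⟨[], .here _, rfl⟩
  | node l r ihl ihr =>
    rcases h with ⟨rfl, rfl⟩ | h | h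
    · exact ⟨[], .here _, rfl⟩
    · obtain ⟨p, hp, e⟩ := ihl h
      exact ⟨false :: p, .left r hp, e⟩
    · obtain ⟨p, hp, e⟩ := ihr h
      exact ⟨true :: p, .right l hp, by simp only [leavesBefore]; omega⟩

theorem SubtreeFrom.hasInterval {S T : BT} {a k : ℕ} (h : SubtreeFrom S a k T) :
    HasInterval a S.numLeaves k T := by
  induction T generalizing k with
  | leaf =>
    obtain ⟨rfl, rfl⟩ := h
    exact ⟨rfl, rfl⟩
  | node l r ihl ihr =>
    rcases h with ⟨rfl, rfl⟩ | h | h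
    · exact Or.inl ⟨rfl, rfl⟩
    · exact Or.inr (Or.inl (ihl h))
    · exact Or.inr (Or.inr (ihr h))

theorem HasInterval.exists_subtreeFrom {T : BT} {a m k : ℕ} (h : HasInterval a m k T) :
    ∃ S, S.numLeaves = m ∧ SubtreeFrom S a k T := by
  induction T generalizing k with
  | leaf =>
    obtain ⟨rfl, rfl⟩ := h
    exact ⟨leaf, rfl, rfl, rfl⟩
  | node l r ihl ihr =>
    rcases h with ⟨rfl, rfl⟩ | h | h
    · exact ⟨_, rfl, .self _ _⟩
    · obtain ⟨S, hS, h⟩ := ihl h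
      exact ⟨S, hS, Or.inr (Or.inl h)⟩
    · obtain ⟨S, hS, h⟩ := ihr h
      exact ⟨S, hS, Or.inr (Or.inr h)⟩

theorem HasInterval.bounds {T : BT} {a m k : ℕ} (h : HasInterval a m k T) :
    k ≤ a ∧ a + m ≤ k + T.numLeaves := by
  induction T generalizing k with
  | leaf => obtain ⟨rfl, rfl⟩ := h; simp [numLeaves]
  | node l r ihl ihr =>
    rcases h with ⟨rfl, rfl⟩ | h | h
    · exact ⟨le_rfl, le_rfl⟩
    · have := ihl h
      simp only [numLeaves]; omega
    · have := ihr h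
      simp only [numLeaves]; omega

theorem SubtreeFrom.eq_of_numLeaves_eq {S T : BT} {a k : ℕ} (h : SubtreeFrom S a k T)
    (e : S.numLeaves = T.numLeaves) : S = T := by
  cases T with
  | leaf => exact h.1
  | node l r =>
    have hl := numLeaves_pos l
    have hr := numLeaves_pos r
    simp only [numLeaves] at e
    rcases h with h | h | h
    · exact h.1
    · have := h.hasInterval.bounds; omega
    · have := h.hasInterval.bounds; omega

/-- If both children of `node l r` are adjacent subtrees of `T`, and `T` has a subtree spanning
the union of their leaf intervals, then that subtree is `node l r`. -/
theorem SubtreeFrom.node {l r T : BT} {a k : ℕ} (hl : SubtreeFrom l a k T)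
    (hr : SubtreeFrom r (a + l.numLeaves) k T)
    (h : HasInterval a (l.numLeaves + r.numLeaves) k T) : SubtreeFrom (node l r) a k T := by
  have pl := numLeaves_pos l
  have pr := numLeaves_pos r
  induction T generalizing k with
  | leaf => have := h.1; omega
  | node x y ihx ihy =>
    have px := numLeaves_pos x
    have py := numLeaves_pos y
    have hb := h.bounds
    simp only [numLeaves] at hb
    rcases h with ⟨e, rfl⟩ | h | h
    · simp only [numLeaves] at e
      rcases hl with ⟨rfl, _⟩ | hl | hl
      · simp only [numLeaves] at *; omega
      · have b1 := hl.hasInterval.bounds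
        rcases hr with ⟨rfl, _⟩ | hr | hr
        · simp only [numLeaves] at *; omega
        · have := hr.hasInterval.bounds; omega
        · have b2 := hr.hasInterval.bounds
          obtain rfl := hl.eq_of_numLeaves_eq (by omega)
          obtain rfl := hr.eq_of_numLeaves_eq (by omega)
          exact .self _ _
      · have := hl.hasInterval.bounds; omega
    · have b := h.bounds
      rcases hl with ⟨rfl, _⟩ | hl | hl
      · simp only [numLeaves] at *; omega
      · rcases hr with ⟨rfl, _⟩ | hr | hr
        · simp only [numLeaves] at *; omega
        · exact Or.inr (Or.inl (ihx hl hr h))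
        · have := hr.hasInterval.bounds; omega
      · have := hl.hasInterval.bounds; omega
    · have b := h.bounds
      rcases hl with ⟨rfl, _⟩ | hl | hl
      · simp only [numLeaves] at *; omega
      · have := hl.hasInterval.bounds; omega
      · rcases hr with ⟨rfl, _⟩ | hr | hr
        · simp only [numLeaves] at *; omega
        · have := hr.hasInterval.bounds; omega
        · exact Or.inr (Or.inr (ihy hl hr h))

/-! ### Restriction to a set of leaves -/

/-- `node` on possibly empty trees. -/
def join : Option BT → Option BT → Option BT
  | none, y => y
  | some x, none => some x
  | some x, some y => some (node x y)

@[simp] theorem join_none_left (y : Option BT) : join none y = y := rfl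

@[simp] theorem join_none_right (x : Option BT) : join x none = x := by cases x <;> rfl

@[simp] theorem join_some (x y : BT) : join (some x) (some y) = some (node x y) := rfl

open Classical in
/-- Delete from `T` the leaves whose position does not satisfy `P`, and suppress the nodes left
with one child; the leaves of `T` are numbered from `k` on. -/
noncomputable def restrict (P : ℕ → Prop) : ℕ → BT → Option BT
  | k, leaf => if P k then some leaf else none
  | k, node l r => join (restrict P k l) (restrict P (k + l.numLeaves) r)

theorem restrict_eq_none {P : ℕ → Prop} {k : ℕ} {T : BT}
    (h : ∀ i, k ≤ i → i < k + T.numLeaves → ¬ P i) : restrict P k T = none := by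
  induction T generalizing k with
  | leaf => simp [restrict, h k le_rfl (by simp [numLeaves])]
  | node l r ihl ihr =>
    simp only [numLeaves] at h
    rw [restrict, ihl fun i h1 h2 => h i h1 (by omega),
      ihr fun i h1 h2 => h i (by omega) (by omega), join_none_left]

theorem restrict_eq_self {P : ℕ → Prop} {k : ℕ} {T : BT}
    (h : ∀ i, k ≤ i → i < k + T.numLeaves → P i) : restrict P k T = some T := by
  induction T generalizing k with
  | leaf => simp [restrict, h k le_rfl (by simp [numLeaves])]
  | node l r ihl ihr =>
    simp only [numLeaves] at h
    rw [restrict, ihl fun i h1 h2 => h i h1 (by omega),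
      ihr fun i h1 h2 => h i (by omega) (by omega), join_some]

/-- Two possibly empty trees are both nonempty and differ by one rotation. -/
def OptRot (x y : Option BT) : Prop := ∃ t u, x = some t ∧ y = some u ∧ Rot t u

theorem OptRot.join_left {x x' : Option BT} (h : OptRot x x') (y : Option BT) :
    OptRot (join x y) (join x' y) := by
  obtain ⟨t, u, rfl, rfl, h⟩ := h
  cases y with
  | none => exact ⟨t, u, rfl, rfl, h⟩
  | some y => exact ⟨_, _, rfl, rfl, .congL y h⟩

theorem OptRot.join_right {y y' : Option BT} (h : OptRot y y') (x : Option BT) :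
    OptRot (join x y) (join x y') := by
  obtain ⟨t, u, rfl, rfl, h⟩ := h
  cases x with
  | none => exact ⟨t, u, rfl, rfl, h⟩
  | some x => exact ⟨_, _, rfl, rfl, .congR x h⟩

theorem join_assoc_or {x y z : Option BT} :
    (join (join x y) z = join x (join y z) ∧ (x = none ∨ y = none ∨ z = none)) ∨
      (OptRot (join (join x y) z) (join x (join y z)) ∧
        OptRot (join x (join y z)) (join (join x y) z)) := by
  rcases x with _ | x
  · simp
  rcases y with _ | y
  · simp
  rcases z with _ | z
  · simp
  exact Or.inr ⟨⟨_, _, rfl, rfl, .rotR x y z⟩, ⟨_, _, rfl, rfl, .rotL x y z⟩⟩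

theorem join_assoc_of_none {x y z : Option BT} (h : x = none ∨ y = none ∨ z = none) :
    join (join x y) z = join x (join y z) := by
  rcases h with rfl | rfl | rfl <;> simp

/-- The positions in the interval of `m` leaves starting at `a`. -/
def Inside (a m i : ℕ) : Prop := a ≤ i ∧ i < a + m

/-- The positions outside the interval of `m` leaves starting at `a`, together with `a`, which
represents the contracted interval. -/
def Outside (a m i : ℕ) : Prop := i ≤ a ∨ a + m ≤ i

theorem restrict_inside_or_outside_none (a m k : ℕ) (A B C : BT) :
    (restrict (Inside a m) k A = none ∨ restrict (Inside a m) (k + A.numLeaves) B = none ∨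
      restrict (Inside a m) (k + A.numLeaves + B.numLeaves) C = none) ∨
    restrict (Outside a m) (k + A.numLeaves) B = none := by
  by_cases h1 : k + A.numLeaves ≤ a
  · exact Or.inl (Or.inl (restrict_eq_none fun i _ _ h => by unfold Inside at h; omega))
  by_cases h2 : a + m ≤ k + A.numLeaves + B.numLeaves
  · exact Or.inl (Or.inr (Or.inr (restrict_eq_none fun i _ _ h => by unfold Inside at h; omega)))
  · exact Or.inr (restrict_eq_none fun i _ _ h => by unfold Outside at h; omega)

/-- A rotation induces a rotation in at most one of the two restrictions. -/
theorem Rot.restrict {T U : BT} (h : Rot T U) (a m k : ℕ) :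
    (restrict (Inside a m) k T = restrict (Inside a m) k U ∧
      (restrict (Outside a m) k T = restrict (Outside a m) k U ∨
        OptRot (restrict (Outside a m) k T) (restrict (Outside a m) k U))) ∨
    (OptRot (restrict (Inside a m) k T) (restrict (Inside a m) k U) ∧
      restrict (Outside a m) k T = restrict (Outside a m) k U) := by
  induction h generalizing k with
  | rotR A B C =>
    simp only [BT.restrict, numLeaves, ← Nat.add_assoc]
    rcases restrict_inside_or_outside_none a m k A B C with h | h
    · exact Or.inl ⟨join_assoc_of_none h, join_assoc_or.imp And.left And.left⟩
    · have e := join_assoc_of_none (x := BT.restrict (Outside a m) k A)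
        (z := BT.restrict (Outside a m) (k + A.numLeaves + B.numLeaves) C) (Or.inr (Or.inl h))
      exact join_assoc_or.imp (fun h => ⟨h.1, Or.inl e⟩) (fun h => ⟨h.1, e⟩)
  | rotL A B C =>
    simp only [BT.restrict, numLeaves, ← Nat.add_assoc]
    rcases restrict_inside_or_outside_none a m k A B C with h | h
    · exact Or.inl ⟨(join_assoc_of_none h).symm,
        join_assoc_or.imp (fun h => h.1.symm) And.right⟩
    · have e := join_assoc_of_none (x := BT.restrict (Outside a m) k A)
        (z := BT.restrict (Outside a m) (k + A.numLeaves + B.numLeaves) C) (Or.inr (Or.inl h))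
      exact join_assoc_or.imp (fun h => ⟨h.1.symm, Or.inl e.symm⟩) (fun h => ⟨h.2, e.symm⟩)
  | congL r h ih =>
    simp only [BT.restrict, h.numLeaves_eq]
    rcases ih k with ⟨e, e₂ | e₂⟩ | ⟨e, e₂⟩
    · exact Or.inl ⟨by rw [e], Or.inl (by rw [e₂])⟩
    · exact Or.inl ⟨by rw [e], Or.inr (e₂.join_left _)⟩
    · exact Or.inr ⟨e.join_left _, by rw [e₂]⟩
  | congR l h ih =>
    simp only [BT.restrict]
    rcases ih (k + l.numLeaves) with ⟨e, e₂ | e₂⟩ | ⟨e, e₂⟩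
    · exact Or.inl ⟨by rw [e], Or.inl (by rw [e₂])⟩
    · exact Or.inl ⟨by rw [e], Or.inr (e₂.join_right _)⟩
    · exact Or.inr ⟨e.join_right _, by rw [e₂]⟩

/-- A rotation destroying the interval changes neither restriction. -/
theorem Rot.restrict_eq {T U : BT} (h : Rot T U) {a m k : ℕ} (hT : HasInterval a m k T)
    (hU : ¬ HasInterval a m k U) :
    BT.restrict (Inside a m) k T = BT.restrict (Inside a m) k U ∧
      BT.restrict (Outside a m) k T = BT.restrict (Outside a m) k U := by
  induction h generalizing k with
  | rotR A B C =>
    simp only [HasInterval, numLeaves, ← Nat.add_assoc] at hT hU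
    have hk : m = A.numLeaves + B.numLeaves ∧ k = a := by tauto
    obtain ⟨rfl, rfl⟩ := hk
    have pA := numLeaves_pos A
    simp only [BT.restrict, numLeaves, ← Nat.add_assoc]
    refine ⟨join_assoc_of_none (Or.inr (Or.inr (restrict_eq_none fun i _ _ h => ?_))),
      join_assoc_of_none (Or.inr (Or.inl (restrict_eq_none fun i _ _ h => ?_)))⟩
    · unfold Inside at h; omega
    · unfold Outside at h; omega
  | rotL A B C =>
    simp only [HasInterval, numLeaves, ← Nat.add_assoc] at hT hU
    have hk : m = B.numLeaves + C.numLeaves ∧ k + A.numLeaves = a := by tauto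
    obtain ⟨rfl, rfl⟩ := hk
    have pB := numLeaves_pos B
    simp only [BT.restrict, numLeaves, ← Nat.add_assoc]
    refine ⟨(join_assoc_of_none (Or.inl (restrict_eq_none fun i _ _ h => ?_))).symm,
      (join_assoc_of_none (Or.inr (Or.inr (restrict_eq_none fun i _ _ h => ?_)))).symm⟩
    · unfold Inside at h; omega
    · unfold Outside at h; omega
  | congL r h ih =>
    simp only [HasInterval, numLeaves, h.numLeaves_eq] at hT hU
    obtain ⟨e, e₂⟩ := ih (k := k) (by tauto) (by tauto)
    simp only [BT.restrict, h.numLeaves_eq, e, e₂, and_self]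
  | congR l h ih =>
    simp only [HasInterval, numLeaves, h.numLeaves_eq] at hT hU
    obtain ⟨e, e₂⟩ := ih (k := k + l.numLeaves) (by tauto) (by tauto)
    simp only [BT.restrict, e, e₂, and_self]

/-! ### Grafting -/

/-- Replace the leaf of `T` at position `a` by `S`; the leaves of `T` are numbered from `k` on. -/
def graft (a : ℕ) (S : BT) : ℕ → BT → BT
  | k, leaf => if k = a then S else leaf
  | k, node l r => node (graft a S k l) (graft a S (k + l.numLeaves) r)

theorem graft_eq_self {a k : ℕ} (S : BT) {T : BT} (h : a < k ∨ k + T.numLeaves ≤ a) :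
    graft a S k T = T := by
  induction T generalizing k with
  | leaf =>
    simp only [numLeaves] at h
    rw [graft, if_neg (by omega)]
  | node l r ihl ihr =>
    simp only [numLeaves] at h
    rw [graft, ihl (by omega), ihr (by omega)]

theorem Rot.graft {T U : BT} (h : Rot T U) (a : ℕ) (S : BT) (k : ℕ) :
    Rot (graft a S k T) (graft a S k U) := by
  induction h generalizing k with
  | rotR A B C =>
    simp only [BT.graft, numLeaves, ← Nat.add_assoc]
    exact .rotR _ _ _
  | rotL A B C =>
    simp only [BT.graft, numLeaves, ← Nat.add_assoc]
    exact .rotL _ _ _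
  | congL r h ih =>
    simp only [BT.graft, h.numLeaves_eq]
    exact .congL _ (ih k)
  | congR l h ih =>
    simp only [BT.graft]
    exact .congR _ (ih _)

theorem Rot.graft_eq_or {S S' : BT} (h : Rot S S') (a k : ℕ) (T : BT) :
    BT.graft a S k T = BT.graft a S' k T ∨ Rot (BT.graft a S k T) (BT.graft a S' k T) := by
  induction T generalizing k with
  | leaf =>
    simp only [BT.graft]
    split_ifs
    · exact Or.inr h
    · exact Or.inl rfl
  | node l r ihl ihr =>
    simp only [BT.graft]
    by_cases ha : a < k + l.numLeaves
    · rw [graft_eq_self S (Or.inl ha), graft_eq_self S' (Or.inl ha)]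
      exact (ihl k).imp (fun e => by rw [e]) (.congL _)
    · rw [graft_eq_self S (Or.inr (not_lt.1 ha)), graft_eq_self S' (Or.inr (not_lt.1 ha))]
      exact (ihr _).imp (fun e => by rw [e]) (.congR _)

/-! ### Projection onto the trees having a given interval -/

/-- The tree obtained from `T` by contracting the interval of `m` leaves starting at `a` to one
leaf, and replacing this leaf by the restriction of `T` to the interval. -/
noncomputable def project (a m : ℕ) (T : BT) : BT :=
  graft a ((restrict (Inside a m) 0 T).getD leaf) 0 ((restrict (Outside a m) 0 T).getD leaf)

theorem Rot.project_eq_or {T U : BT} (h : Rot T U) (a m : ℕ) :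
    project a m T = project a m U ∨ Rot (project a m T) (project a m U) := by
  unfold project
  rcases h.restrict a m 0 with ⟨e, e₂ | ⟨t, u, e1, e2, e₂⟩⟩ | ⟨⟨t, u, e1, e2, e₂⟩, e⟩
  · exact Or.inl (by rw [e, e₂])
  · rw [e, e1, e2]
    exact Or.inr (e₂.graft _ _ _)
  · rw [e, e1, e2]
    exact e₂.graft_eq_or _ _ _

theorem SubtreeFrom.restrict_inside {S T : BT} {a k : ℕ} (h : SubtreeFrom S a k T) :
    restrict (Inside a S.numLeaves) k T = some S := by
  induction T generalizing k with
  | leaf =>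
    obtain ⟨rfl, rfl⟩ := h
    exact restrict_eq_self fun i h1 h2 => ⟨h1, h2⟩
  | node l r ihl ihr =>
    rcases h with ⟨rfl, rfl⟩ | h | h
    · exact restrict_eq_self fun i h1 h2 => ⟨h1, h2⟩
    · have b := h.hasInterval.bounds
      rw [restrict, ihl h, restrict_eq_none, join_none_right]
      intro i _ _ hi
      unfold Inside at hi; omega
    · have b := h.hasInterval.bounds
      rw [restrict, ihr h, restrict_eq_none, join_none_left]
      intro i _ _ hi
      unfold Inside at hi; omega

theorem restrict_outside_self (S : BT) (a : ℕ) :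
    restrict (Outside a S.numLeaves) a S = some leaf := by
  suffices H : ∀ m, S.numLeaves ≤ m → restrict (Outside a m) a S = some leaf from H _ le_rfl
  intro m hm
  induction S with
  | leaf => simp [restrict, Outside]
  | node l r ihl _ =>
    simp only [numLeaves] at hm
    have := numLeaves_pos l
    rw [restrict, ihl (by omega), restrict_eq_none, join_none_right]
    intro i _ _ hi
    unfold Outside at hi; omega

theorem SubtreeFrom.restrict_outside {S T : BT} {a k : ℕ} (h : SubtreeFrom S a k T) :
    ∃ T', restrict (Outside a S.numLeaves) k T = some T' ∧ graft a S k T' = T ∧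
      a < k + T'.numLeaves := by
  have top : ∃ T', restrict (Outside a S.numLeaves) a S = some T' ∧ graft a S a T' = S ∧
      a < a + T'.numLeaves :=
    ⟨leaf, restrict_outside_self S a, by simp [graft], by simp [numLeaves]⟩
  induction T generalizing k with
  | leaf =>
    obtain ⟨rfl, rfl⟩ := h
    exact top
  | node l r ihl ihr =>
    rcases h with ⟨rfl, rfl⟩ | h | h
    · exact top
    · have b := h.hasInterval.bounds
      obtain ⟨l', e, g, hl⟩ := ihl h
      refine ⟨BT.node l' r, ?_, ?_, ?_⟩
      · rw [restrict, e, restrict_eq_self, join_some]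
        intro i _ _
        unfold Outside; omega
      · rw [graft, g, graft_eq_self S (Or.inl hl)]
      · simp only [numLeaves]; omega
    · have b := h.hasInterval.bounds
      obtain ⟨r', e, g, hr⟩ := ihr h
      refine ⟨BT.node l r', ?_, ?_, ?_⟩
      · rw [restrict, e, restrict_eq_self, join_some]
        intro i _ _
        unfold Outside; omega
      · rw [graft, g, graft_eq_self S (Or.inr b.1)]
      · simp only [numLeaves]; omega

theorem HasInterval.project_eq {T : BT} {a m : ℕ} (h : HasInterval a m 0 T) :
    project a m T = T := by
  obtain ⟨S, rfl, hS⟩ := h.exists_subtreeFrom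
  obtain ⟨T', e, g, _⟩ := hS.restrict_outside
  rw [project, e, hS.restrict_inside]
  exact g

/-! ### Geodesics -/

theorem exists_rotSeq_of_eq_or_rot (n : ℕ) (g : ℕ → BT)
    (h : ∀ i < n, g i = g (i + 1) ∨ Rot (g i) (g (i + 1))) :
    ∃ m ≤ n, RotSeq m (g 0) (g n) ∧ ((∃ j < n, g j = g (j + 1)) → m < n) := by
  induction n generalizing g with
  | zero => exact ⟨0, le_rfl, .refl _, by simp⟩
  | succ n ih =>
    obtain ⟨m, hm, hs, hlt⟩ := ih (fun i => g (i + 1)) fun i hi => h (i + 1) (by omega)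
    by_cases e : g 0 = g 1
    · exact ⟨m, by omega, e ▸ hs, fun _ => by omega⟩
    · refine ⟨m + 1, by omega, .step ((h 0 (by omega)).resolve_left e) hs, ?_⟩
      rintro ⟨_ | j, hj, hje⟩
      · exact absurd hje e
      · have := hlt ⟨j, by omega, hje⟩
        omega

/-- Along a geodesic between two trees having a given interval, all trees have it. -/
theorem hasInterval_of_geodesic {n a m : ℕ} {f : ℕ → BT}
    (h0 : HasInterval a m 0 (f 0)) (hn : HasInterval a m 0 (f n))
    (hstep : ∀ i < n, Rot (f i) (f (i + 1))) (hmin : n = rotDist (f 0) (f n)) :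
    ∀ i ≤ n, HasInterval a m 0 (f i) := by
  intro i
  induction i with
  | zero => exact fun _ => h0
  | succ i ih =>
    intro hi
    by_contra hU
    have hT := ih (by omega)
    obtain ⟨e, e₂⟩ := (hstep i hi).restrict_eq hT hU
    obtain ⟨d, _, hs, hlt⟩ := exists_rotSeq_of_eq_or_rot n (fun j => project a m (f j))
      fun j hj => (hstep j hj).project_eq_or a m
    have hd : d < n := hlt ⟨i, hi, by simp only [project, e, e₂]⟩
    simp only [h0.project_eq, hn.project_eq] at hs
    have : rotDist (f 0) (f n) ≤ d := Nat.sInf_le hs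
    omega

theorem SubtreeFrom.of_node {l r T : BT} {a k : ℕ} (h : SubtreeFrom (BT.node l r) a k T) :
    SubtreeFrom l a k T ∧ SubtreeFrom r (a + l.numLeaves) k T := by
  induction T generalizing k with
  | leaf => exact absurd h.1 (by simp)
  | node x y ihx ihy =>
    rcases h with ⟨e, rfl⟩ | h | h
    · cases e
      exact ⟨Or.inr (Or.inl (.self _ _)), Or.inr (Or.inr (.self _ _))⟩
    · exact ⟨Or.inr (Or.inl (ihx h).1), Or.inr (Or.inl (ihx h).2)⟩
    · exact ⟨Or.inr (Or.inr (ihy h).1), Or.inr (Or.inr (ihy h).2)⟩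

theorem subtreeFrom_of_geodesic {n a : ℕ} {f : ℕ → BT} {S : BT}
    (h0 : SubtreeFrom S a 0 (f 0)) (hn : SubtreeFrom S a 0 (f n))
    (hstep : ∀ i < n, Rot (f i) (f (i + 1))) (hmin : n = rotDist (f 0) (f n))
    {i : ℕ} (hi : i ≤ n) : SubtreeFrom S a 0 (f i) := by
  have hS := hasInterval_of_geodesic h0.hasInterval hn.hasInterval hstep hmin i hi
  induction S generalizing a with
  | leaf =>
    obtain ⟨S, e, h⟩ := hS.exists_subtreeFrom
    cases S with
    | leaf => exact h
    | node l r =>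
      have := numLeaves_pos l
      have := numLeaves_pos r
      simp only [numLeaves] at e
      omega
  | node l r ihl ihr =>
    obtain ⟨hl0, hr0⟩ := h0.of_node
    obtain ⟨hln, hrn⟩ := hn.of_node
    have hl := hasInterval_of_geodesic hl0.hasInterval hln.hasInterval hstep hmin i hi
    have hr := hasInterval_of_geodesic hr0.hasInterval hrn.hasInterval hstep hmin i hi
    exact (ihl hl0 hln hl).node (ihr hr0 hrn hr) hS

/-- If `T₁` and `T₂` share a common subtree `S` at the same
leaf positions, then along any minimal-length sequence of rotations
transforming `T₁` into `T₂` (a sequence of length `rotDist T₁ T₂`), no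
rotation alters `S`: every intermediate tree contains `S` as a subtree at the
same leaf positions. -/
theorem geodesic_preserves_common_subtree
    (T₁ T₂ S : BT) (p₁ p₂ : List Bool) (n : ℕ) (f : ℕ → BT)
    (hleaves : T₁.numLeaves = T₂.numLeaves)
    (h₁ : OccursAt S T₁ p₁) (h₂ : OccursAt S T₂ p₂)
    (hpos : leavesBefore T₁ p₁ = leavesBefore T₂ p₂)
    (hf0 : f 0 = T₁) (hfn : f n = T₂)
    (hstep : ∀ i < n, Rot (f i) (f (i + 1)))
    (hmin : n = rotDist T₁ T₂) :
    ∀ i ≤ n, ∃ p, OccursAt S (f i) p ∧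
      leavesBefore (f i) p = leavesBefore T₁ p₁ := by
  subst hf0 hfn
  intro i hi
  have h0 := h₁.subtreeFrom 0
  have hn := h₂.subtreeFrom 0
  rw [← hpos] at hn
  obtain ⟨p, hp, e⟩ := (subtreeFrom_of_geodesic h0 hn hstep hmin hi).exists_occursAt
  exact ⟨p, hp, by omega⟩

end BT
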